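/- arXiv:math/9703205 — 3 statements merged into one kernel-verified Lean document; each statement's English description precedes it below -/
import Mathlib

section
/- Let f : [0,∞) → ℂ satisfy |f(x)| ≤ C(1+x)^(−α) with α > 1/2. Then for Lebesgue-almost every λ ∈ ℝ the improper integral ∫₀^∞ exp(iλx) f(x) dx converges, and for every δ > 0, for almost every λ, ∫_N^∞ exp(iλx) f(x) dx = o(N^(−α+1/2+δ)) as N → ∞. -/
open MeasureTheory Filter Real Set intervalIntegral
open scoped Topology

theorem L2 (g : ℝ → ℂ) (hg : Measurable g) (a b M : ℝ) (hab : a ≤ b) (hM0 : 0 ≤ M)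
    (hM : ∀ x, ‖g x‖ ≤ M) :
    ∫⁻ l : ℝ, ENNReal.ofReal (rexp (-l^2) *
      ‖∫ x in Ioc a b, Complex.exp (Complex.I * (l:ℂ) * (x:ℂ)) * g x‖^2)
     ≤ ENNReal.ofReal (2 * π * M^2 * (b - a)) := by
  set μ := (volume : Measure ℝ).restrict (Ioc a b) with hμ
  set e : ℝ → ℝ → ℂ := fun l x => Complex.exp (Complex.I * (l:ℂ) * (x:ℂ)) * g x with he
  have hen : ∀ l x, ‖e l x‖ ≤ M := by
    intro l x
    have : ‖Complex.exp (Complex.I * (l:ℂ) * (x:ℂ))‖ = 1 := by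
      rw [Complex.norm_exp]; simp
    simp only [he, norm_mul, this, one_mul]; exact hM x
  set F : ℝ → ℂ := fun l => ∫ x, e l x ∂μ with hF
  let H : ℝ → ℝ × ℝ → ℂ := fun l p => (rexp (-l^2) : ℂ) * (e l p.1 * (starRingEnd ℂ) (e l p.2))
  have hG : Integrable (fun l : ℝ => rexp (-l^2)) := by
    simpa using integrable_exp_neg_mul_sq (b := 1) one_pos
  have hHm : Measurable (Function.uncurry H) := by
    simp only [H, he, Function.uncurry_def]
    have := Complex.continuous_conj.measurable
    fun_prop
  have hHi : Integrable (Function.uncurry H) (volume.prod (μ.prod μ)) := by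
    have h1 : Integrable (fun z : ℝ × (ℝ × ℝ) => rexp (-z.1^2) * M^2) (volume.prod (μ.prod μ)) :=
      Integrable.mul_prod hG (integrable_const (M^2))
    refine h1.mono' hHm.aestronglyMeasurable (ae_of_all _ ?_)
    rintro ⟨l, x, y⟩
    simp only [Function.uncurry, H, norm_mul, RCLike.norm_conj]
    rw [Complex.norm_real, Real.norm_of_nonneg (exp_pos _).le]
    have := hen l x
    have := hen l y
    gcongr
    rw [sq]; gcongr
  have hin : ∀ l, ∫ p, H l p ∂(μ.prod μ) = ((rexp (-l^2) * ‖F l‖^2 : ℝ) : ℂ) := by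
    intro l
    simp only [H]
    rw [MeasureTheory.integral_const_mul,
      integral_prod_mul (fun x => e l x) (fun y => (starRingEnd ℂ) (e l y)), integral_conj]
    rw [Complex.mul_conj, Complex.normSq_eq_norm_sq]
    push_cast; rfl
  have hint : Integrable (fun l => rexp (-l^2) * ‖F l‖^2) := by
    have := hHi.integral_prod_left
    simp only [Function.uncurry, hin] at this
    exact_mod_cast this.re
  rw [← ofReal_integral_eq_lintegral_ofReal hint (ae_of_all _ fun l => by positivity)]
  apply ENNReal.ofReal_le_ofReal
  have hsw := integral_integral_swap hHi
  simp only [hin] at hsw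
  rw [integral_complex_ofReal] at hsw
  have hK : ∀ p : ℝ × ℝ, ‖∫ l, H l p‖ ≤ M^2 * (√π * rexp (-(1/4) * (p.1 - p.2)^2)) := by
    rintro ⟨x, y⟩
    have h1 : ∀ l, H l (x,y) = (g x * (starRingEnd ℂ) (g y)) *
        (Complex.exp (Complex.I * ((x - y : ℝ) : ℂ) * l) * Complex.exp (-1 * (l:ℂ)^2)) := by
      intro l
      simp only [H, he, map_mul, ← Complex.exp_conj, Complex.conj_I, Complex.conj_ofReal]
      have : Complex.exp (Complex.I * ((x - y : ℝ) : ℂ) * l) =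
        Complex.exp (Complex.I * l * x) * Complex.exp (-Complex.I * l * y) := by
        rw [← Complex.exp_add]; congr 1; push_cast; ring
      rw [this]; push_cast; simp only [neg_one_mul]; ring
    simp only [h1]
    rw [MeasureTheory.integral_const_mul, fourierIntegral_gaussian (by simp), norm_mul, norm_mul, norm_mul,
      RCLike.norm_conj]
    have e1 : ‖((π:ℂ) / 1) ^ (1/2 : ℂ)‖ = √π := by
      rw [div_one, show (1/2:ℂ) = ((1/2:ℝ):ℂ) by push_cast; rfl, ← Complex.ofReal_cpow pi_pos.le,
        Complex.norm_real, Real.sqrt_eq_rpow, Real.norm_of_nonneg (by positivity)]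
    have e2 : ‖Complex.exp (-((x - y : ℝ):ℂ)^2 / (4 * 1))‖ = rexp (-(1/4) * (x - y)^2) := by
      rw [show -((x - y : ℝ):ℂ)^2 / (4 * 1) = ((-(1/4) * (x - y)^2 : ℝ) : ℂ) by push_cast; ring,
        ← Complex.ofReal_exp, Complex.norm_real, Real.norm_of_nonneg (exp_pos _).le]
    rw [e1, e2]
    gcongr
    rw [sq]; gcongr
    · exact hM x
    · exact hM y
  have hgi : Integrable (fun t : ℝ => rexp (-(1/4) * t^2)) := integrable_exp_neg_mul_sq (by norm_num)
  have hbi : Integrable (fun p : ℝ × ℝ => M^2 * (√π * rexp (-(1/4) * (p.1 - p.2)^2))) (μ.prod μ) := by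
    refine (integrable_const (M^2 * √π)).mono' (by fun_prop) (ae_of_all _ fun p => ?_)
    rw [Real.norm_of_nonneg (by positivity), ← mul_assoc]
    apply mul_le_of_le_one_right (by positivity)
    rw [Real.exp_le_one_iff]; nlinarith [sq_nonneg (p.1 - p.2)]
  have hfin : ∀ x, ∫ y, M^2 * (√π * rexp (-(1/4) * (x - y)^2)) ∂μ ≤ 2 * π * M^2 := by
    intro x
    rw [MeasureTheory.integral_const_mul, MeasureTheory.integral_const_mul]
    have : ∫ y, rexp (-(1/4) * (x - y)^2) ∂μ ≤ ∫ y, rexp (-(1/4) * (x - y)^2) :=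
      setIntegral_le_integral (hgi.comp_sub_left x) (ae_of_all _ fun _ => (exp_pos _).le)
    rw [integral_sub_left_eq_self (fun t => rexp (-(1/4) * t^2)) volume, integral_gaussian] at this
    have h4 : √(π / (1/4)) = 2 * √π := by
      rw [show π / (1/4) = 2^2 * π by ring, Real.sqrt_mul (by norm_num), Real.sqrt_sq (by norm_num)]
    rw [h4] at this
    calc _ ≤ M^2 * (√π * (2 * √π)) := by gcongr
      _ = M^2 * (2 * (√π * √π)) := by ring
      _ = _ := by rw [Real.mul_self_sqrt pi_pos.le]; ring
  calc ∫ l, rexp (-l^2) * ‖F l‖^2 ≤ ‖((∫ l, rexp (-l^2) * ‖F l‖^2 : ℝ):ℂ)‖ := by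
        rw [Complex.norm_real]; exact le_abs_self _
    _ = ‖∫ p, (∫ l, H l p) ∂(μ.prod μ)‖ := by rw [hsw]
    _ ≤ ∫ p, M^2 * (√π * rexp (-(1/4) * (p.1 - p.2)^2)) ∂(μ.prod μ) :=
        norm_integral_le_of_norm_le hbi (ae_of_all _ hK)
    _ = ∫ x, ∫ y, M^2 * (√π * rexp (-(1/4) * (x - y)^2)) ∂μ ∂μ := integral_prod _ hbi
    _ ≤ ∫ x, 2 * π * M^2 ∂μ := integral_mono hbi.integral_prod_left (integrable_const _) hfin
    _ = _ := by simp [hμ, hab]; ring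

theorem ae_bound (f : ℝ → ℂ) (hmeas : Measurable f) (C α γ : ℝ) (hC : 0 < C) (hα : 1/2 < α)
    (hγ : γ < α - 1/2)
    (hf : ∀ x ≥ (0:ℝ), ‖f x‖ ≤ C * (1 + x) ^ (-α)) :
    ∀ᵐ l : ℝ, ∃ A ≥ (0:ℝ), ∀ j m : ℕ,
      ‖∫ x in (((m:ℝ)+1)*2^j)..(((m:ℝ)+2)*2^j),
        Complex.exp (Complex.I * (l:ℂ) * (x:ℂ)) * f x‖ ≤ A * (((m:ℝ)+1)*2^j) ^ (-γ) := by
  let X : ℕ × ℕ → ℝ := fun i => ((i.2:ℝ)+1)*2^i.1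
  have hX : ∀ i, 0 < X i := fun i => by positivity
  let Y : ℕ × ℕ → ℝ := fun i => ((i.2:ℝ)+2)*2^i.1
  have hXY : ∀ i, Y i - X i = 2^i.1 := fun i => by simp only [X, Y]; ring
  have hXY' : ∀ i, X i ≤ Y i := fun i => by
    have := hXY i
    have : (0:ℝ) < 2^i.1 := by positivity
    linarith
  let T : ℕ × ℕ → ℝ → ℂ := fun i l => ∫ x in (X i)..(Y i),
        Complex.exp (Complex.I * (l:ℂ) * (x:ℂ)) * f x
  have hTm : ∀ i, Measurable (T i) := by
    intro i
    have : T i = fun l : ℝ => ∫ x in Ioc (X i) (Y i), Complex.exp (Complex.I * (l:ℂ) * (x:ℂ)) * f x := by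
      ext l; simp only [T]; rw [integral_of_le (hXY' i)]
    rw [this]
    apply StronglyMeasurable.measurable
    apply StronglyMeasurable.integral_prod_right
      (f := fun l x : ℝ => Complex.exp (Complex.I * (l:ℂ) * (x:ℂ)) * f x)
    apply Measurable.stronglyMeasurable
    simp only [Function.uncurry_def]
    fun_prop
  have hT2 : ∀ i, ∫⁻ l : ℝ, ENNReal.ofReal (rexp (-l^2) * ‖T i l‖^2)
      ≤ ENNReal.ofReal (2 * π * (C * X i ^ (-α))^2 * 2^i.1) := by
    intro i
    have hXp := hX i
    have := L2 ((Ioc (X i) (Y i)).indicator f) (hmeas.indicator measurableSet_Ioc) (X i) (Y i)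
      (C * X i ^ (-α)) (hXY' i) (by positivity) ?_
    · rw [hXY] at this
      convert this using 6 with l
      simp only [T]
      rw [integral_of_le (hXY' i)]
      congr 1
      apply setIntegral_congr_fun measurableSet_Ioc
      intro x hx
      simp only [indicator_of_mem hx]
    · intro x
      by_cases hx : x ∈ Ioc (X i) (Y i)
      · rw [indicator_of_mem hx]
        refine (hf x (hXp.le.trans hx.1.le)).trans ?_
        gcongr ?_ * ?_
        exact Real.rpow_le_rpow_of_nonpos hXp (by linarith [hx.1]) (by linarith)
      · rw [indicator_of_notMem hx]; simp; positivity
  let h : ℕ × ℕ → ℝ → ENNReal := fun i l =>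
    ENNReal.ofReal (X i ^ (2*γ)) * ENNReal.ofReal (rexp (-l^2) * ‖T i l‖^2)
  have hhm : ∀ i, Measurable (h i) := by
    intro i
    have := hTm i
    simp only [h]
    fun_prop
  have hsum : Summable (fun i : ℕ × ℕ => 2 * π * C^2 *
      (((2:ℝ)^(2*γ-2*α+1))^i.1 * ((i.2:ℝ)+1)^(2*γ-2*α))) := by
    apply Summable.mul_left
    apply Summable.mul_of_nonneg (f := fun j : ℕ => ((2:ℝ)^(2*γ-2*α+1))^j)
      (g := fun m : ℕ => ((m:ℝ)+1)^(2*γ-2*α))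
    · apply summable_geometric_of_lt_one (by positivity)
      exact Real.rpow_lt_one_of_one_lt_of_neg (by norm_num) (by linarith)
    · have := (summable_nat_add_iff 1).2 (Real.summable_nat_rpow (p := 2*γ-2*α).2 (by linarith))
      simpa using this
    · intro j; simp only [Pi.zero_apply]; positivity
    · intro j; simp only [Pi.zero_apply]; positivity
  have hle : ∀ i, ∫⁻ l, h i l ≤ ENNReal.ofReal (2 * π * C^2 *
      (((2:ℝ)^(2*γ-2*α+1))^i.1 * ((i.2:ℝ)+1)^(2*γ-2*α))) := by
    intro i
    simp only [h]
    rw [lintegral_const_mul _ (by have := hTm i; fun_prop)]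
    refine (mul_le_mul_right (hT2 i) _).trans ?_
    rw [← ENNReal.ofReal_mul (by have := hX i; positivity)]
    apply le_of_eq
    congr 1
    have e1 : (X i ^ (-α))^2 = X i ^ (-2*α) := by
      rw [← Real.rpow_natCast, ← Real.rpow_mul (hX i).le]; congr 1; push_cast; ring
    have e2 : X i ^ (2*γ) * X i ^ (-2*α) = X i ^ (2*γ-2*α) := by
      rw [← Real.rpow_add (hX i)]; congr 1; ring
    have e3 : X i ^ (2*γ-2*α) = ((i.2:ℝ)+1)^(2*γ-2*α) * ((2:ℝ)^(2*γ-2*α))^i.1 := by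
      simp only [X]
      rw [Real.mul_rpow (by positivity) (by positivity), ← Real.rpow_natCast, ← Real.rpow_natCast,
        ← Real.rpow_mul (by positivity), ← Real.rpow_mul (by positivity), mul_comm (i.1:ℝ)]
    calc _ = 2 * π * C^2 * (X i ^ (2*γ) * (X i ^ (-α))^2) * 2^i.1 := by ring
      _ = _ := by rw [e1, e2, e3, Real.rpow_add_one (by norm_num), mul_pow]; ring
  have hfin : ∀ᵐ l, ∑' i, h i l < ⊤ := by
    apply ae_lt_top (Measurable.tsum hhm)
    rw [lintegral_tsum (fun i => (hhm i).aemeasurable)]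
    refine ne_top_of_le_ne_top ?_ (ENNReal.tsum_le_tsum hle)
    exact hsum.tsum_ofReal_ne_top
  filter_upwards [hfin] with l hl
  let G := (∑' i, h i l).toReal
  refine ⟨√(G * rexp (l^2)), Real.sqrt_nonneg _, fun j m => ?_⟩
  have h1 : h (j,m) l ≤ ∑' i, h i l := ENNReal.le_tsum _
  have h2 := ENNReal.toReal_mono hl.ne h1
  have hXp := hX (j,m)
  simp only [h] at h2
  rw [ENNReal.toReal_mul, ENNReal.toReal_ofReal (by positivity), ENNReal.toReal_ofReal (by positivity)] at h2
  change ‖T (j,m) l‖ ≤ _ * X (j,m) ^ (-γ)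
  change _ ≤ G at h2
  have hG : 0 ≤ G := ENNReal.toReal_nonneg
  apply le_of_sq_le_sq _ (by positivity)
  rw [mul_pow, Real.sq_sqrt (by positivity)]
  have e1 : (X (j,m) ^ (-γ))^2 = (X (j,m) ^ (2*γ))⁻¹ := by
    rw [← Real.rpow_natCast, ← Real.rpow_mul hXp.le, ← Real.rpow_neg hXp.le]; congr 1; push_cast; ring
  rw [e1]
  rw [Real.exp_neg] at h2
  have hp : 0 < X (j,m) ^ (2*γ) := by positivity
  rw [← div_eq_mul_inv, le_div_iff₀ hp]
  have he := exp_pos (l^2)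
  calc ‖T (j,m) l‖^2 * X (j,m) ^ (2*γ) =
      X (j,m) ^ (2*γ) * ((rexp (l^2))⁻¹ * ‖T (j,m) l‖^2) * rexp (l^2) := by field_simp
    _ ≤ _ := by gcongr

theorem dyadic (S : ℝ → ℂ) (A γ γ' : ℝ) (hA : 0 ≤ A) (hγ : 0 < γ) (hγγ : γ < γ')
    (h1 : ∀ j m : ℕ, ‖S (((m:ℝ)+2)*2^j) - S (((m:ℝ)+1)*2^j)‖ ≤ A * (((m:ℝ)+1)*2^j) ^ (-γ'))
    (h2 : ∀ n : ℕ, 1 ≤ n → ∀ N : ℝ, (n:ℝ) ≤ N → N ≤ n + 1 → ‖S N - S n‖ ≤ A * (n:ℝ) ^ (-γ')) :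
    ∃ L : ℂ, ∃ B ≥ (0:ℝ), ∀ N ≥ (1:ℝ), ‖L - S N‖ ≤ B * N ^ (-γ) := by
  set r : ℝ := 2 ^ (-γ') with hr
  have hr0 : 0 < r := by positivity
  have hr1 : r < 1 := Real.rpow_lt_one_of_one_lt_of_neg (by norm_num) (by linarith)
  have hrk : ∀ k : ℕ, ((2:ℝ)^k) ^ (-γ') = r ^ k := by
    intro k
    rw [hr, ← Real.rpow_natCast, ← Real.rpow_natCast, ← Real.rpow_mul (by norm_num),
      ← Real.rpow_mul (by norm_num), mul_comm]
  have hmono : ∀ (k : ℕ) (x : ℝ), (2:ℝ)^k ≤ x → x ^ (-γ') ≤ r ^ k := by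
    intro k x hx
    rw [← hrk]
    exact Real.rpow_le_rpow_of_nonpos (by positivity) hx (by linarith)
  have hgeo : ∀ k : ℕ, dist (S (2^k)) (S (2^(k+1))) ≤ A * r ^ k := by
    intro k
    have := h1 k 0
    rw [dist_comm, dist_eq_norm]
    simp only [Nat.cast_zero, zero_add, one_mul, hrk] at this
    rwa [pow_succ']
  obtain ⟨L, hL⟩ := cauchySeq_tendsto_of_complete (cauchySeq_of_le_geometric r A hr1 hgeo)
  have hLk := dist_le_of_le_geometric_of_tendsto r A hr1 hgeo hL
  have hstep : ∀ n : ℕ, 1 ≤ n → ∀ j ≤ Nat.log 2 n,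
      ‖S n - S ((n / 2^j * 2^j : ℕ):ℝ)‖ ≤ j * (A * r ^ (Nat.log 2 n)) := by
    intro n hn j
    set k := Nat.log 2 n with hk
    have hkn : 2^k ≤ n := Nat.pow_log_le_self 2 (by omega)
    induction j with
    | zero => intro _; simp
    | succ j ih =>
      intro hj
      have ih := ih (by omega)
      have hB : ‖S ((n / 2^j * 2^j : ℕ):ℝ) - S ((n / 2^(j+1) * 2^(j+1) : ℕ):ℝ)‖ ≤ A * r ^ k := by
        set p := n / 2^(j+1) with hp
        have hq : n / 2^j / 2 = p := by rw [hp, pow_succ, Nat.div_div_eq_div_mul]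
        have hpk : 2^(k-(j+1)) ≤ p := by
          rw [hp, Nat.le_div_iff_mul_le (by positivity), ← pow_add]
          rwa [Nat.sub_add_cancel hj]
        have hp1 : 1 ≤ p := le_trans Nat.one_le_two_pow hpk
        have hpk2 : 2^k ≤ p * 2^(j+1) := by
          calc 2^k = 2^(k-(j+1)) * 2^(j+1) := by rw [← pow_add, Nat.sub_add_cancel hj]
            _ ≤ _ := by gcongr
        have hpk3 : (2:ℝ)^k ≤ p * 2^(j+1) := by exact_mod_cast hpk2
        rcases Nat.even_or_odd' (n / 2^j) with ⟨q, h | h⟩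
        · have : q = p := by omega
          rw [this] at h
          rw [h, show 2 * p * 2^j = p * 2^(j+1) by ring]
          simp; positivity
        · have : q = p := by omega
          rw [this] at h
          rw [h]
          have h3 := h1 j (2*p-1)
          have hc : ((2*p-1 : ℕ):ℝ) = 2*p-1 := by
            rw [Nat.cast_sub (by omega)]; push_cast; rfl
          rw [hc] at h3
          have e1 : (((2*p+1)*2^j : ℕ):ℝ) = (2*(p:ℝ)-1+2)*2^j := by push_cast; ring
          have e2 : ((p*2^(j+1) : ℕ):ℝ) = (2*(p:ℝ)-1+1)*2^j := by push_cast; ring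
          rw [e1, e2]
          refine h3.trans ?_
          gcongr
          apply hmono
          refine hpk3.trans (le_of_eq ?_)
          ring
      calc _ ≤ ‖S n - S ((n / 2^j * 2^j : ℕ):ℝ)‖ +
            ‖S ((n / 2^j * 2^j : ℕ):ℝ) - S ((n / 2^(j+1) * 2^(j+1) : ℕ):ℝ)‖ :=
            norm_sub_le_norm_sub_add_norm_sub _ _ _
        _ ≤ j * (A * r ^ k) + A * r ^ k := add_le_add ih hB
        _ = _ := by push_cast; ring
  -- k * s^k bounded
  set s : ℝ := 2 ^ (γ - γ') with hs
  have hs0 : 0 < s := by positivity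
  have hs1 : s < 1 := Real.rpow_lt_one_of_one_lt_of_neg (by norm_num) (by linarith)
  obtain ⟨K, hK⟩ : ∃ K, ∀ k : ℕ, (k:ℝ) * s^k ≤ K := by
    have := tendsto_pow_const_mul_const_pow_of_abs_lt_one 1 (r := s) (by rwa [abs_of_pos hs0])
    obtain ⟨K, hK⟩ := this.bddAbove_range
    refine ⟨K, fun k => ?_⟩
    have := hK (mem_range_self k)
    simpa using this
  have hK0 : 0 ≤ K := by simpa using hK 0
  have hrs : ∀ k : ℕ, r^k = s^k * ((2:ℝ)^(-γ))^k := by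
    intro k
    rw [← mul_pow, hs, ← Real.rpow_add (by norm_num), hr]; congr 2; ring
  have h1r : 0 < 1 - r := by linarith
  refine ⟨L, (A / (1-r) + A * K + A) * 2^γ, by positivity, fun N hN => ?_⟩
  set n := ⌊N⌋₊ with hn
  have hn1 : 1 ≤ n := Nat.one_le_floor_iff N |>.2 hN
  set k := Nat.log 2 n with hk
  have hkn : 2^k ≤ n := Nat.pow_log_le_self 2 (by omega)
  have hkn' : n < 2^(k+1) := Nat.lt_pow_succ_log_self (by norm_num) n
  have hdiv : n / 2^k * 2^k = 2^k := by
    have : n / 2^k = 1 := by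
      apply Nat.div_eq_of_lt_le
      · simpa using hkn
      · rw [pow_succ'] at hkn'; simpa using hkn'
    rw [this, one_mul]
  have a1 := hstep n hn1 k le_rfl
  rw [hdiv] at a1
  push_cast at a1
  have a2 := hLk k
  rw [dist_comm, dist_eq_norm] at a2
  have a3 := h2 n hn1 N (Nat.floor_le (by linarith)) (Nat.lt_floor_add_one N).le
  have a4 : (n:ℝ)^(-γ') ≤ r^k := hmono k n (by exact_mod_cast hkn)
  have a5 : ‖L - S N‖ ≤ (A / (1-r)) * r^k + A * (k * r^k) + A * r^k := by
    have t : L - S N = (L - S (2^k)) - (S n - S (2^k)) - (S N - S n) := by ring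
    rw [t]
    refine (norm_sub_le _ _).trans (add_le_add ((norm_sub_le _ _).trans (add_le_add ?_ ?_)) ?_)
    · exact a2.trans (le_of_eq (by ring))
    · exact a1.trans (le_of_eq (by ring))
    · exact a3.trans (by gcongr)
  have hsk : s^k ≤ 1 := pow_le_one₀ hs0.le hs1.le
  have hN2 : N ≤ 2 * 2^k := by
    have : N < n + 1 := Nat.lt_floor_add_one N
    have : (n:ℝ) + 1 ≤ 2^(k+1) := by exact_mod_cast hkn'
    rw [pow_succ'] at this
    linarith
  have b1 : ((2:ℝ)^(-γ))^k ≤ 2^γ * N^(-γ) := by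
    have : (2 * 2^k : ℝ)^(-γ) ≤ N^(-γ) :=
      Real.rpow_le_rpow_of_nonpos (by linarith) hN2 (by linarith)
    have e : (2 * 2^k : ℝ)^(-γ) = 2^(-γ) * ((2:ℝ)^(-γ))^k := by
      rw [Real.mul_rpow (by positivity) (by positivity)]
      congr 1
      rw [← Real.rpow_natCast, ← Real.rpow_natCast, ← Real.rpow_mul (by norm_num),
      ← Real.rpow_mul (by norm_num), mul_comm]
    rw [e] at this
    calc ((2:ℝ)^(-γ))^k = 2^γ * (2^(-γ) * ((2:ℝ)^(-γ))^k) := by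
          rw [← mul_assoc, ← Real.rpow_add (by norm_num)]; simp
      _ ≤ _ := by gcongr
  have hu : 0 ≤ ((2:ℝ)^(-γ))^k := by positivity
  calc ‖L - S N‖ ≤ (A / (1-r)) * r^k + A * (k * r^k) + A * r^k := a5
    _ = (A / (1-r) * s^k + A * (k * s^k) + A * s^k) * ((2:ℝ)^(-γ))^k := by rw [hrs]; ring
    _ ≤ (A / (1-r) * 1 + A * K + A * 1) * ((2:ℝ)^(-γ))^k := by
        gcongr
        exact hK k
    _ ≤ (A / (1-r) * 1 + A * K + A * 1) * (2^γ * N^(-γ)) := by gcongr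
    _ = _ := by ring

theorem key (f : ℝ → ℂ) (hmeas : Measurable f) (C α γ : ℝ) (hC : 0 < C) (hα : 1/2 < α)
    (hγ0 : 0 < γ) (hγ : γ < α - 1/2)
    (hf : ∀ x ≥ (0:ℝ), ‖f x‖ ≤ C * (1 + x) ^ (-α)) :
    ∀ᵐ l : ℝ, ∃ L : ℂ, ∃ B ≥ (0:ℝ), ∀ N ≥ (1:ℝ),
      ‖L - ∫ x in (0:ℝ)..N, Complex.exp (Complex.I * (l:ℂ) * (x:ℂ)) * f x‖ ≤ B * N ^ (-γ) := by
  obtain ⟨γ', g1, g2⟩ := exists_between hγ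
  filter_upwards [ae_bound f hmeas C α γ' hC hα g2 hf] with l ⟨A, hA, hl⟩
  have hnorm : ∀ x : ℝ, ‖Complex.exp (Complex.I * (l:ℂ) * (x:ℂ)) * f x‖ = ‖f x‖ := by
    intro x
    rw [norm_mul, Complex.norm_exp]; simp
  have hii : ∀ a b : ℝ, 0 ≤ a → a ≤ b → IntervalIntegrable
      (fun x : ℝ => Complex.exp (Complex.I * (l:ℂ) * (x:ℂ)) * f x) volume a b := by
    intro a b ha hab
    rw [intervalIntegrable_iff_integrableOn_Ioc_of_le hab]
    refine Measure.integrableOn_of_bounded (M := C) (by simp) (by fun_prop) ?_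
    refine (ae_restrict_iff' measurableSet_Ioc).2 (ae_of_all _ fun x hx => ?_)
    rw [hnorm]
    have hx0 : 0 ≤ x := ha.trans hx.1.le
    refine (hf x hx0).trans (mul_le_of_le_one_right hC.le ?_)
    exact Real.rpow_le_one_of_one_le_of_nonpos (by linarith) (by linarith)
  have hsub : ∀ a b : ℝ, 0 ≤ a → a ≤ b →
      (∫ x in (0:ℝ)..b, Complex.exp (Complex.I * (l:ℂ) * (x:ℂ)) * f x) -
      (∫ x in (0:ℝ)..a, Complex.exp (Complex.I * (l:ℂ) * (x:ℂ)) * f x) =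
      ∫ x in a..b, Complex.exp (Complex.I * (l:ℂ) * (x:ℂ)) * f x := by
    intro a b ha hab
    exact integral_interval_sub_left (hii 0 b le_rfl (ha.trans hab)) (hii 0 a le_rfl ha)
  apply dyadic (fun N => ∫ x in (0:ℝ)..N, Complex.exp (Complex.I * (l:ℂ) * (x:ℂ)) * f x)
    (max A C) γ γ' (by positivity) hγ0 g1
  · intro j m
    rw [hsub _ _ (by positivity) (by gcongr; norm_num)]
    refine (hl j m).trans ?_
    gcongr
    exact le_max_left _ _
  · intro n hn N hN hN'
    have hn' : (1:ℝ) ≤ n := by exact_mod_cast hn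
    rw [hsub _ _ (by positivity) hN]
    have := intervalIntegral.norm_integral_le_of_norm_le_const (a := (n:ℝ)) (b := N) (C := C * (n:ℝ)^(-γ'))
      (f := fun x : ℝ => Complex.exp (Complex.I * (l:ℂ) * (x:ℂ)) * f x) ?_
    · refine this.trans ?_
      rw [abs_of_nonneg (by linarith)]
      refine (mul_le_of_le_one_right (by positivity) (by linarith)).trans ?_
      gcongr
      exact le_max_right _ _
    · intro x hx
      rw [uIoc_of_le hN] at hx
      rw [hnorm]
      refine (hf x (by linarith [hx.1])).trans ?_
      gcongr ?_ * ?_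
      calc (1+x)^(-α) ≤ (n:ℝ)^(-α) :=
            Real.rpow_le_rpow_of_nonpos (by linarith) (by linarith [hx.1]) (by linarith)
        _ ≤ _ := Real.rpow_le_rpow_of_exponent_le hn' (by linarith)

theorem stmt4 (f : ℝ → ℂ) (hmeas : Measurable f) (C α : ℝ) (hC : 0 < C) (hα : 1/2 < α)
    (hf : ∀ x ≥ (0:ℝ), ‖f x‖ ≤ C * (1 + x) ^ (-α)) :
    (∀ᵐ lam : ℝ, ∃ L : ℂ,
      Tendsto (fun N : ℝ => ∫ x in (0:ℝ)..N,
        Complex.exp (Complex.I * (lam:ℂ) * (x:ℂ)) * f x) atTop (𝓝 L)) ∧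
    ∀ δ > (0:ℝ), ∀ᵐ lam : ℝ, ∃ L : ℂ,
      Tendsto (fun N : ℝ => ∫ x in (0:ℝ)..N,
        Complex.exp (Complex.I * (lam:ℂ) * (x:ℂ)) * f x) atTop (𝓝 L) ∧
      Tendsto (fun N : ℝ => N ^ (α - 1/2 - δ) *
        ‖L - ∫ x in (0:ℝ)..N, Complex.exp (Complex.I * (lam:ℂ) * (x:ℂ)) * f x‖)
        atTop (𝓝 0) := by
  have main : ∀ δ > (0:ℝ), ∀ᵐ lam : ℝ, ∃ L : ℂ,
      Tendsto (fun N : ℝ => ∫ x in (0:ℝ)..N,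
        Complex.exp (Complex.I * (lam:ℂ) * (x:ℂ)) * f x) atTop (𝓝 L) ∧
      Tendsto (fun N : ℝ => N ^ (α - 1/2 - δ) *
        ‖L - ∫ x in (0:ℝ)..N, Complex.exp (Complex.I * (lam:ℂ) * (x:ℂ)) * f x‖)
        atTop (𝓝 0) := by
    intro δ hδ
    obtain ⟨γ, g1, g2⟩ := exists_between (show max 0 (α - 1/2 - δ) < α - 1/2 from
      max_lt (by linarith) (by linarith))
    have g3 : 0 < γ := (le_max_left _ _).trans_lt g1
    have g4 : α - 1/2 - δ < γ := (le_max_right _ _).trans_lt g1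
    filter_upwards [key f hmeas C α γ hC hα g3 g2 hf] with l ⟨L, B, hB, hl⟩
    refine ⟨L, ?_, ?_⟩
    · rw [tendsto_iff_norm_sub_tendsto_zero]
      have ht : Tendsto (fun N : ℝ => B * N ^ (-γ)) atTop (𝓝 0) := by
        simpa using (tendsto_rpow_neg_atTop g3).const_mul B
      refine squeeze_zero' (Eventually.of_forall fun _ => norm_nonneg _) ?_ ht
      filter_upwards [eventually_ge_atTop 1] with N hN
      rw [norm_sub_rev]
      exact hl N hN
    · have ht : Tendsto (fun N : ℝ => B * N ^ (-(γ - (α - 1/2 - δ)))) atTop (𝓝 0) := by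
        simpa using (tendsto_rpow_neg_atTop (sub_pos.2 g4)).const_mul B
      refine squeeze_zero' ?_ ?_ ht
      · filter_upwards [eventually_ge_atTop 1] with N hN
        positivity
      · filter_upwards [eventually_ge_atTop 1] with N hN
        have hN0 : 0 < N := by linarith
        calc _ ≤ N ^ (α - 1/2 - δ) * (B * N ^ (-γ)) := by
              gcongr
              exact hl N hN
          _ = B * (N ^ (α - 1/2 - δ) * N ^ (-γ)) := by ring
          _ = _ := by rw [← Real.rpow_add hN0]; congr 2; ring
  refine ⟨?_, main⟩
  filter_upwards [main 1 one_pos] with l ⟨L, hL, _⟩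
  exact ⟨L, hL⟩
end

section
/- Let f : [0,∞) → ℂ satisfy |f(ξ)| ≤ C(1+ξ)^(−α−ε) with α ≥ 5/6 and ε > 0. Then for Lebesgue-almost every λ ∈ ℝ the improper integral ∫₀^∞ f(ξ) exp(iλ ξ^(1/3)) dξ converges as N → ∞, and for almost every λ there is a constant C(λ) with |∫_N^∞ f(ξ) exp(iλ ξ^(1/3)) dξ| ≤ C(λ) N^(−α+5/6) for all large N. -/
open MeasureTheory Filter Real Set intervalIntegral
open scoped Topology


lemma det_chain (S : ℕ → ℂ) (A σ : ℝ) (hA : 0 ≤ A) (hσ : 0 < σ)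
    (h : ∀ j m : ℕ, 1 ≤ m → ‖S ((m+1) * 2^j) - S (m * 2^j)‖ ≤ A * ((m:ℝ) * 2^j) ^ (-σ)) :
    ∀ i j m : ℕ, 2^i ≤ m → m < 2^(i+1) →
      ‖S (m * 2^j) - S (2^(i+j))‖ ≤ i * (A * ((2:ℝ)^(i+j)) ^ (-σ)) := by
  intro i
  induction i with
  | zero =>
    intro j m h1 h2
    have : m = 1 := by simp at h1 h2; omega
    subst this
    simp
  | succ i ih =>
    intro j m h1 h2
    have e1 : 2^(i+1) = 2 * 2^i := by ring
    have e2 : 2^(i+1+1) = 4 * 2^i := by ring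
    have := ih (j+1) (m/2) (by omega) (by omega)
    have e3 : i + (j+1) = i + 1 + j := by ring
    rw [e3] at this
    have hpos : 0 ≤ A * ((2:ℝ)^(i+1+j)) ^ (-σ) := by positivity
    rcases Nat.even_or_odd' m with ⟨q, rfl | rfl⟩
    · have e4 : 2 * q / 2 = q := by omega
      have e5 : 2 * q * 2^j = q * 2^(j+1) := by ring
      rw [e4] at this
      rw [e5]
      refine this.trans ?_
      push_cast
      nlinarith
    · have e4 : (2 * q + 1) / 2 = q := by omega
      have e5 : 2 * q * 2^j = q * 2^(j+1) := by ring
      rw [e4, ← e5] at this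
      have hq : 2^(i+1) ≤ 2 * q := by omega
      have hpp : 0 < 2^i := by positivity
      have h3 := h j (2*q) (by omega)
      have h4 : A * (((2*q:ℕ):ℝ) * 2^j) ^ (-σ) ≤ A * ((2:ℝ)^(i+1+j)) ^ (-σ) := by
        apply mul_le_mul_of_nonneg_left _ hA
        apply Real.rpow_le_rpow_of_nonpos (by positivity) _ (by linarith)
        rw [pow_add]
        apply mul_le_mul_of_nonneg_right _ (by positivity)
        exact_mod_cast hq
      calc ‖S ((2*q+1) * 2^j) - S (2^(i+1+j))‖
          ≤ ‖S ((2*q+1) * 2^j) - S (2*q * 2^j)‖ + ‖S (2*q * 2^j) - S (2^(i+1+j))‖ :=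
            norm_sub_le_norm_sub_add_norm_sub _ _ _
        _ ≤ A * ((2:ℝ)^(i+1+j)) ^ (-σ) + i * (A * ((2:ℝ)^(i+1+j)) ^ (-σ)) :=
            add_le_add (h3.trans h4) this
        _ = _ := by push_cast; ring

lemma det_lim (S : ℕ → ℂ) (A σ τ : ℝ) (hA : 0 ≤ A) (hτ : 0 < τ) (hσ : τ < σ)
    (h : ∀ j m : ℕ, 1 ≤ m → ‖S ((m+1) * 2^j) - S (m * 2^j)‖ ≤ A * ((m:ℝ) * 2^j) ^ (-σ)) :
    ∃ (L : ℂ) (K : ℝ), 0 ≤ K ∧ ∀ n : ℕ, 1 ≤ n → ‖L - S n‖ ≤ K * (n:ℝ) ^ (-τ) := by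
  have hσ0 : 0 < σ := hτ.trans hσ
  set r : ℝ := (2:ℝ) ^ (-σ) with hr
  set s : ℝ := (2:ℝ) ^ (-τ) with hs
  have hr0 : 0 < r := by positivity
  have hs0 : 0 < s := by positivity
  have hr1 : r < 1 := Real.rpow_lt_one_of_one_lt_of_neg (by norm_num) (by linarith)
  have hrs : r < s := Real.rpow_lt_rpow_of_exponent_lt (by norm_num) (by linarith)
  have hrk : ∀ k : ℕ, ((2:ℝ)^k) ^ (-σ) = r ^ k := fun k => by
    rw [hr, ← Real.rpow_natCast, ← Real.rpow_natCast, ← Real.rpow_mul (by norm_num),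
      ← Real.rpow_mul (by norm_num), mul_comm]
  have hsk : ∀ k : ℕ, ((2:ℝ)^k) ^ (-τ) = s ^ k := fun k => by
    rw [hs, ← Real.rpow_natCast, ← Real.rpow_natCast, ← Real.rpow_mul (by norm_num),
      ← Real.rpow_mul (by norm_num), mul_comm]
  have hd : ∀ k : ℕ, dist (S (2^k)) (S (2^(k+1))) ≤ A * r ^ k := fun k => by
    have := h k 1 le_rfl
    rw [dist_comm, dist_eq_norm]
    simp only [one_mul, Nat.cast_one, hrk] at this
    rwa [show 2^(k+1) = (1+1) * 2^k by ring]
  obtain ⟨L, hL⟩ := cauchySeq_tendsto_of_complete (cauchySeq_of_le_geometric r A hr1 hd)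
  have hL2 := dist_le_of_le_geometric_of_tendsto r A hr1 hd hL
  obtain ⟨P, hP⟩ := (tendsto_self_mul_const_pow_of_lt_one (r := r/s) (by positivity)
    ((div_lt_one hs0).2 hrs)).bddAbove_range
  have hP' : ∀ k : ℕ, k * r^k ≤ P * s^k := fun k => by
    have := hP ⟨k, rfl⟩
    simp only [div_pow] at this
    rwa [← mul_div_assoc, div_le_iff₀ (by positivity)] at this
  have hP0 : 0 ≤ P := by have := hP' 0; simpa using this
  refine ⟨L, (A / (1-r) + A * P) / s, ?_, ?_⟩
  · have : 0 < 1 - r := by linarith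
    positivity
  intro n hn
  set k := Nat.log 2 n
  have hk1 : 2^k ≤ n := Nat.pow_log_le_self 2 (by omega)
  have hk2 : n < 2^(k+1) := Nat.lt_pow_succ_log_self (by norm_num) n
  have h1 := det_chain S A σ hA hσ0 h k 0 n hk1 hk2
  simp only [pow_zero, mul_one, add_zero, hrk] at h1
  have h2 := hL2 k
  rw [dist_comm, dist_eq_norm] at h2
  have h3 : s^(k+1) ≤ (n:ℝ)^(-τ) := by
    rw [← hsk]
    apply Real.rpow_le_rpow_of_nonpos (by exact_mod_cast hn) _ (by linarith)
    exact_mod_cast hk2.le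
  have hrsk : r^k ≤ s^k := pow_le_pow_left₀ hr0.le hrs.le k
  have h1r : 0 < 1 - r := by linarith
  calc ‖L - S n‖ ≤ ‖L - S (2^k)‖ + ‖S (2^k) - S n‖ := norm_sub_le_norm_sub_add_norm_sub _ _ _
    _ ≤ A * r^k / (1-r) + k * (A * r^k) := add_le_add h2 (by rwa [norm_sub_rev])
    _ = A / (1-r) * r^k + A * (k * r^k) := by ring
    _ ≤ A / (1-r) * s^k + A * (P * s^k) := by
        exact add_le_add (mul_le_mul_of_nonneg_left hrsk (by positivity))
          (mul_le_mul_of_nonneg_left (hP' k) hA)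
    _ = (A / (1-r) + A * P) / s * s^(k+1) := by rw [pow_succ]; field_simp
    _ ≤ _ := by gcongr


lemma meas_F (h : ℝ → ℂ) (hm : Measurable h) (ν : Measure ℝ) [SFinite ν] :
    Measurable (fun lam : ℝ => ∫ y, h y * Complex.exp (Complex.I * (lam:ℂ) * (y:ℂ)) ∂ν) := by
  apply StronglyMeasurable.measurable
  apply StronglyMeasurable.integral_prod_right
    (f := fun (lam y : ℝ) => h y * Complex.exp (Complex.I * (lam:ℂ) * (y:ℂ)))
  apply Measurable.stronglyMeasurable
  unfold Function.uncurry
  fun_prop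

lemma norm_ker (lam y : ℝ) : ‖Complex.exp (Complex.I * (lam:ℂ) * (y:ℂ))‖ = 1 := by
  rw [Complex.norm_exp]; simp

lemma l2_core (h : ℝ → ℂ) (hm : Measurable h) (a b B : ℝ) (hab : a ≤ b)
    (hB : ∀ y, ‖h y‖ ≤ B) :
    Integrable (fun lam : ℝ => ‖∫ y in Ioc a b, h y * Complex.exp (Complex.I * (lam:ℂ) * (y:ℂ))‖^2)
      (ProbabilityTheory.gaussianReal 0 1) ∧
    ∫ lam : ℝ, ‖∫ y in Ioc a b, h y * Complex.exp (Complex.I * (lam:ℂ) * (y:ℂ))‖^2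
      ∂(ProbabilityTheory.gaussianReal 0 1) ≤ B^2 * √(2*π) * (b - a) := by
  set μ := ProbabilityTheory.gaussianReal 0 1 with hμ
  set ν := (volume : Measure ℝ).restrict (Ioc a b) with hν
  have hB0 : 0 ≤ B := (norm_nonneg _).trans (hB 0)
  have hνr : ν.real univ = b - a := by
    simp [hν, Measure.real, hab]
  constructor
  · refine Integrable.of_bound ?_ ((B * (b-a))^2) ?_
    · exact ((meas_F h hm ν).norm.pow_const 2).aestronglyMeasurable
    · refine Eventually.of_forall fun lam => ?_
      rw [Real.norm_of_nonneg (by positivity)]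
      gcongr
      rw [← hνr]
      apply MeasureTheory.norm_integral_le_of_norm_le_const
      refine Eventually.of_forall fun y => ?_
      rw [norm_mul, norm_ker, mul_one]
      exact hB y
  let c : ℝ × ℝ → ℂ := fun z => h z.1 * (starRingEnd ℂ) (h z.2)
  have hc : Measurable c := by
    have : Measurable (starRingEnd ℂ) := Complex.continuous_conj.measurable
    fun_prop
  have hcB : ∀ z, ‖c z‖ ≤ B^2 := fun z => by
    simp only [c, norm_mul, RCLike.norm_conj, sq]
    exact mul_le_mul (hB _) (hB _) (norm_nonneg _) hB0
  have e1 : ∀ lam : ℝ, ((‖∫ y, h y * Complex.exp (Complex.I * (lam:ℂ) * (y:ℂ)) ∂ν‖^2 : ℝ) : ℂ)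
      = ∫ z, c z * Complex.exp (Complex.I * (lam:ℂ) * ((z.1 - z.2 : ℝ):ℂ)) ∂(ν.prod ν) := by
    intro lam
    have := integral_prod_mul (μ := ν) (ν := ν)
      (fun y : ℝ => h y * Complex.exp (Complex.I * (lam:ℂ) * (y:ℂ)))
      (fun y : ℝ => (starRingEnd ℂ) (h y * Complex.exp (Complex.I * (lam:ℂ) * (y:ℂ))))
    rw [integral_conj, Complex.mul_conj, Complex.normSq_eq_norm_sq] at this
    rw [← this]
    congr 1
    ext z
    simp only [c, map_mul, ← Complex.exp_conj, Complex.conj_I, Complex.conj_ofReal]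
    rw [show Complex.I * (lam:ℂ) * ((z.1 - z.2 : ℝ):ℂ)
      = Complex.I * (lam:ℂ) * z.1 + (-Complex.I * (lam:ℂ) * z.2) by push_cast; ring, Complex.exp_add]
    ring
  have e2 : ((∫ lam : ℝ, ‖∫ y, h y * Complex.exp (Complex.I * (lam:ℂ) * (y:ℂ)) ∂ν‖^2 ∂μ : ℝ) : ℂ)
      = ∫ z, c z * Complex.exp (-(((z.1 - z.2 : ℝ):ℂ))^2/2) ∂(ν.prod ν) := by
    rw [← integral_complex_ofReal]
    simp_rw [e1]
    rw [integral_integral_swap]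
    · congr 1
      ext z
      rw [MeasureTheory.integral_const_mul]
      congr 1
      have := ProbabilityTheory.charFun_gaussianReal (μ := 0) (v := 1) (z.1 - z.2)
      rw [charFun_apply_real] at this
      simp only [Complex.ofReal_zero, mul_zero, zero_mul, zero_sub, NNReal.coe_one,
        Complex.ofReal_one, one_mul] at this
      rw [neg_div, ← this]
      congr 1
      ext x
      congr 1
      ring
    · refine Integrable.of_bound ?_ (B^2) ?_
      · apply Measurable.aestronglyMeasurable
        unfold Function.uncurry
        fun_prop
      · refine Eventually.of_forall fun p => ?_
        simp only [Function.uncurry]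
        rw [norm_mul, norm_ker, mul_one]
        exact hcB _
  have e3 : ∀ z : ℝ × ℝ, ‖c z * Complex.exp (-(((z.1 - z.2 : ℝ):ℂ))^2/2)‖
      ≤ B^2 * rexp (-(1/2) * (z.1 - z.2)^2) := by
    intro z
    rw [norm_mul]
    have : ‖Complex.exp (-(((z.1 - z.2 : ℝ):ℂ))^2/2)‖ = rexp (-(1/2) * (z.1 - z.2)^2) := by
      rw [show (-(((z.1 - z.2 : ℝ):ℂ))^2/2) = ((-(1/2) * (z.1 - z.2)^2 : ℝ) : ℂ) by push_cast; ring,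
        Complex.norm_exp_ofReal]
    rw [this]
    gcongr
    exact hcB z
  have hint : Integrable (fun z : ℝ × ℝ => B^2 * rexp (-(1/2) * (z.1 - z.2)^2)) (ν.prod ν) := by
    refine Integrable.of_bound ?_ (B^2) ?_
    · apply Measurable.aestronglyMeasurable
      fun_prop
    · refine Eventually.of_forall fun z => ?_
      rw [Real.norm_of_nonneg (by positivity)]
      have : rexp (-(1/2) * (z.1 - z.2)^2) ≤ 1 := by
        apply Real.exp_le_one_iff.2; nlinarith [sq_nonneg (z.1 - z.2)]
      nlinarith [sq_nonneg B]
  have e4 : ∀ x : ℝ, ∫ y, B^2 * rexp (-(1/2) * (x - y)^2) ∂ν ≤ B^2 * √(2*π) := by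
    intro x
    rw [MeasureTheory.integral_const_mul]
    gcongr
    have i1 : Integrable (fun y : ℝ => rexp (-(1/2) * (x - y)^2)) :=
      (integrable_exp_neg_mul_sq (b := 1/2) (by norm_num)).comp_sub_left x
    calc ∫ y, rexp (-(1/2) * (x - y)^2) ∂ν ≤ ∫ y, rexp (-(1/2) * (x - y)^2) :=
          setIntegral_le_integral i1 (Eventually.of_forall fun y => by positivity)
      _ = ∫ y, rexp (-(1/2) * y^2) :=
          integral_sub_left_eq_self (fun y : ℝ => rexp (-(1/2) * y^2)) volume x
      _ = √(2*π) := by rw [integral_gaussian]; congr 1; ring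
  have hn : 0 ≤ ∫ lam : ℝ, ‖∫ y, h y * Complex.exp (Complex.I * (lam:ℂ) * (y:ℂ)) ∂ν‖^2 ∂μ :=
    integral_nonneg fun _ => by positivity
  rw [← Real.norm_of_nonneg hn, ← Complex.norm_real, e2]
  calc _ ≤ ∫ z : ℝ × ℝ, B^2 * rexp (-(1/2) * (z.1 - z.2)^2) ∂(ν.prod ν) :=
        norm_integral_le_of_norm_le hint (Eventually.of_forall e3)
    _ = ∫ x, ∫ y, B^2 * rexp (-(1/2) * (x - y)^2) ∂ν ∂ν := integral_prod _ hint
    _ ≤ ∫ x, B^2 * √(2*π) ∂ν :=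
        integral_mono hint.integral_prod_left (integrable_const _) e4
    _ = _ := by rw [MeasureTheory.integral_const, hνr, smul_eq_mul, mul_comm]

lemma l2_bound (h : ℝ → ℂ) (hm : Measurable h) (a b B : ℝ) (hab : a ≤ b) (hB0 : 0 ≤ B)
    (hB : ∀ y ∈ Ioc a b, ‖h y‖ ≤ B) :
    ∫⁻ lam : ℝ, ENNReal.ofReal
      (‖∫ y in Ioc a b, h y * Complex.exp (Complex.I * (lam:ℂ) * (y:ℂ))‖^2)
      ∂(ProbabilityTheory.gaussianReal 0 1) ≤ ENNReal.ofReal (B^2 * √(2*π) * (b - a)) := by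
  obtain ⟨h1, h2⟩ := l2_core ((Ioc a b).indicator h) (hm.indicator measurableSet_Ioc) a b B hab
    (fun y => by
      by_cases hy : y ∈ Ioc a b
      · simpa [hy] using hB y hy
      · simpa [hy] using hB0)
  have e : ∀ lam : ℝ, ∫ y in Ioc a b, h y * Complex.exp (Complex.I * (lam:ℂ) * (y:ℂ)) =
      ∫ y in Ioc a b, (Ioc a b).indicator h y * Complex.exp (Complex.I * (lam:ℂ) * (y:ℂ)) := by
    intro lam
    apply setIntegral_congr_fun measurableSet_Ioc
    intro y hy
    simp [hy]
  simp_rw [e]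
  rw [← ofReal_integral_eq_lintegral_ofReal h1 (Eventually.of_forall fun _ => by positivity)]
  exact ENNReal.ofReal_le_ofReal h2

lemma ae_bound_s5 (g : ℝ → ℂ) (hm : Measurable g) (K γ σ : ℝ) (hK : 0 ≤ K) (hγ : 0 ≤ γ)
    (hg : ∀ y ≥ (1:ℝ), ‖g y‖ ≤ K * y ^ (-γ)) (hσ : 1 < 2 * γ - 2 * σ) :
    ∀ᵐ lam : ℝ, ∃ A : ℝ, 0 ≤ A ∧ ∀ j m : ℕ, 1 ≤ m →
      ‖∫ y in Ioc ((m:ℝ) * 2^j) (((m:ℝ)+1) * 2^j),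
        g y * Complex.exp (Complex.I * (lam:ℂ) * (y:ℂ))‖ ≤ A * ((m:ℝ) * 2^j) ^ (-σ) := by
  apply (ProbabilityTheory.gaussianReal_absolutelyContinuous' 0 one_ne_zero).ae_le
  set μ := ProbabilityTheory.gaussianReal 0 1 with hμ
  let x : ℕ × ℕ → ℝ := fun p => ((p.2 + 1 : ℕ) : ℝ) * 2^p.1
  let F : ℕ × ℕ → ℝ → ℝ := fun p lam =>
    ‖∫ y in Ioc (x p) ((((p.2 + 1 : ℕ) : ℝ) + 1) * 2^p.1),
        g y * Complex.exp (Complex.I * (lam:ℂ) * (y:ℂ))‖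
  have hx0 : ∀ p, 0 < x p := fun p => by simp only [x]; positivity
  have hx1 : ∀ p, 1 ≤ x p := fun p => by
    simp only [x]
    have : (1:ℝ) ≤ ((p.2 + 1 : ℕ) : ℝ) := by simp
    exact one_le_mul_of_one_le_of_one_le this (one_le_pow₀ (by norm_num))
  have hFm : ∀ p, Measurable (F p) := fun p => (meas_F g hm _).norm
  have hF : ∀ p, ∫⁻ lam, ENNReal.ofReal (F p lam ^ 2) ∂μ ≤
      ENNReal.ofReal ((K * (x p)^(-γ))^2 * √(2*π) * 2^p.1) := by
    intro p
    have := l2_bound g hm (x p) ((((p.2 + 1 : ℕ) : ℝ) + 1) * 2^p.1) (K * (x p)^(-γ))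
      (by simp only [x]; gcongr; simp) (by have := hx0 p; positivity)
      (fun y hy => (hg y ((hx1 p).trans hy.1.le)).trans
        (mul_le_mul_of_nonneg_left (Real.rpow_le_rpow_of_nonpos (hx0 p) hy.1.le (by linarith)) hK))
    refine this.trans (le_of_eq ?_)
    congr 2
    simp only [x]; ring
  have key : ∫⁻ lam, ∑' p, ENNReal.ofReal ((x p)^(2*σ)) * ENNReal.ofReal (F p lam ^ 2) ∂μ ≠ ⊤ := by
    rw [lintegral_tsum (fun p => by
      have := hFm p
      exact Measurable.aemeasurable (by fun_prop))]
    set θ := 2*γ - 2*σ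
    have hs1 : Summable (fun j : ℕ => ((2:ℝ)^(1-θ))^j) :=
      summable_geometric_of_lt_one (by positivity)
        (Real.rpow_lt_one_of_one_lt_of_neg (by norm_num) (by linarith))
    have hs2 : Summable (fun m : ℕ => ((m + 1 : ℕ):ℝ)^(-θ)) :=
      (summable_nat_add_iff 1).2 (Real.summable_nat_rpow.2 (by linarith))
    have hs := ((hs1.mul_of_nonneg hs2 (fun _ => by positivity)
      (fun _ => by positivity)).mul_left (K^2 * √(2*π))).tsum_ofReal_ne_top
    refine ne_top_of_le_ne_top hs (ENNReal.tsum_le_tsum fun p => ?_)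
    have := hFm p
    rw [lintegral_const_mul _ (by fun_prop)]
    refine (mul_le_mul_right (hF p) _).trans ?_
    have hxp := hx0 p
    rw [← ENNReal.ofReal_mul (by positivity)]
    apply le_of_eq
    congr 1
    have a1 : (x p)^(2*σ) * ((x p)^(-γ))^2 = (x p)^(-θ) := by
      rw [← Real.rpow_natCast ((x p)^(-γ)), ← Real.rpow_mul hxp.le, ← Real.rpow_add hxp]
      congr 1
      push_cast
      simp only [θ]; ring
    have a2 : (x p)^(-θ) * 2^p.1 = ((2:ℝ)^(1-θ))^p.1 * ((p.2 + 1 : ℕ):ℝ)^(-θ) := by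
      simp only [x]
      rw [Real.mul_rpow (by positivity) (by positivity), sub_eq_add_neg, Real.rpow_add (by norm_num),
        Real.rpow_one, mul_pow, ← Real.rpow_natCast 2 p.1, ← Real.rpow_mul (by norm_num),
        ← Real.rpow_natCast ((2:ℝ)^(-θ)) p.1, ← Real.rpow_mul (by norm_num), mul_comm (p.1:ℝ)]
      ring
    calc _ = K^2 * √(2*π) * (((x p)^(2*σ) * ((x p)^(-γ))^2) * 2^p.1) := by ring
      _ = _ := by rw [a1, a2]
  have hae := ae_lt_top' (Measurable.aemeasurable (by
    apply Measurable.tsum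
    intro p
    have := hFm p
    fun_prop)) key
  filter_upwards [hae] with lam hlam
  set T := ∑' p, ENNReal.ofReal ((x p)^(2*σ)) * ENNReal.ofReal (F p lam ^ 2) with hT
  refine ⟨√T.toReal, by positivity, fun j m hm1 => ?_⟩
  have h1 := ENNReal.le_tsum (f := fun p => ENNReal.ofReal ((x p)^(2*σ)) * ENNReal.ofReal (F p lam ^ 2))
    (j, m-1)
  rw [← hT] at h1
  set p : ℕ × ℕ := (j, m-1) with hp
  have hxp := hx0 p
  have hxe : (m:ℝ) * 2^j = x p := by
    simp only [x, hp, Nat.sub_add_cancel hm1]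
  have hFe : ‖∫ y in Ioc ((m:ℝ) * 2^j) (((m:ℝ)+1) * 2^j),
        g y * Complex.exp (Complex.I * (lam:ℂ) * (y:ℂ))‖ = F p lam := by
    simp only [F, x, hp, Nat.sub_add_cancel hm1]
  rw [hFe, hxe]
  rw [← ENNReal.ofReal_mul (by positivity), ENNReal.ofReal_le_iff_le_toReal hlam.ne] at h1
  have h2 := Real.sqrt_le_sqrt h1
  rw [two_mul, Real.rpow_add hxp, ← sq, ← mul_pow, Real.sqrt_sq (by
    have : 0 ≤ F p lam := norm_nonneg _
    positivity)] at h2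
  rw [Real.rpow_neg hxp.le, ← div_eq_mul_inv, le_div_iff₀ (by positivity), mul_comm]
  exact h2

lemma cov (f : ℝ → ℂ) (lam M : ℝ) (hM : 0 ≤ M) :
    ∫ ξ in (0:ℝ)..M^3, f ξ * Complex.exp (Complex.I * (lam:ℂ) * ((ξ ^ ((1:ℝ)/3) : ℝ) : ℂ))
      = ∫ y in (0:ℝ)..M, (((3 * y^2 : ℝ) : ℂ) * f (y^3)) *
          Complex.exp (Complex.I * (lam:ℂ) * (y:ℂ)) := by
  have himg : (fun y : ℝ => y^3) '' Ioc 0 M = Ioc 0 (M^3) := by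
    ext z
    constructor
    · rintro ⟨y, hy, rfl⟩
      exact ⟨pow_pos hy.1 3, pow_le_pow_left₀ hy.1.le hy.2 3⟩
    · intro hz
      have e : (z^((1:ℝ)/3))^3 = z := by
        rw [← Real.rpow_natCast, ← Real.rpow_mul hz.1.le]; norm_num
      refine ⟨z^((1:ℝ)/3), ⟨Real.rpow_pos_of_pos hz.1 _, ?_⟩, e⟩
      apply le_of_pow_le_pow_left₀ (n := 3) (by norm_num) hM
      rw [e]; exact hz.2
  have hinj : InjOn (fun y : ℝ => y^3) (Ioc 0 M) := by
    intro y hy z hz h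
    exact (pow_left_inj₀ hy.1.le hz.1.le (by norm_num)).1 h
  rw [intervalIntegral.integral_of_le (by positivity), intervalIntegral.integral_of_le hM, ← himg,
    integral_image_eq_integral_abs_deriv_smul measurableSet_Ioc
      (f' := fun y => 3 * y^2) (fun y _ => by
        simpa using (hasDerivAt_pow 3 y).hasDerivWithinAt) hinj]
  apply setIntegral_congr_fun measurableSet_Ioc
  intro y hy
  have e : (y^3)^((1:ℝ)/3) = y := by
    rw [← Real.rpow_natCast, ← Real.rpow_mul hy.1.le]; norm_num
  simp only [e]
  rw [abs_of_nonneg (by positivity), Complex.real_smul]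
  ring

theorem stmt5 (f : ℝ → ℂ) (hmeas : Measurable f) (C α ε : ℝ) (hC : 0 < C)
    (hα : (5:ℝ)/6 ≤ α) (hε : 0 < ε)
    (hf : ∀ ξ ≥ (0:ℝ), ‖f ξ‖ ≤ C * (1 + ξ) ^ (-α - ε)) :
    ∀ᵐ lam : ℝ, ∃ L : ℂ,
      Tendsto (fun N : ℝ => ∫ ξ in (0:ℝ)..N,
        f ξ * Complex.exp (Complex.I * (lam:ℂ) * ((ξ ^ ((1:ℝ)/3) : ℝ) : ℂ))) atTop (𝓝 L) ∧
      ∃ Clam N₀ : ℝ, ∀ N ≥ N₀,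
        ‖L - ∫ ξ in (0:ℝ)..N,
            f ξ * Complex.exp (Complex.I * (lam:ℂ) * ((ξ ^ ((1:ℝ)/3) : ℝ) : ℂ))‖
          ≤ Clam * N ^ (-α + 5/6) := by
  let g : ℝ → ℂ := fun y => ((3 * y^2 : ℝ) : ℂ) * f (y^3)
  have hgm : Measurable g := by fun_prop
  have hgn : ∀ y ≥ (0:ℝ), ‖g y‖ ≤ 3 * y^2 * (C * (1 + y^3) ^ (-α - ε)) := by
    intro y hy
    simp only [g]
    rw [norm_mul, Complex.norm_real, Real.norm_of_nonneg (by positivity)]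
    exact mul_le_mul_of_nonneg_left (hf _ (by positivity)) (by positivity)
  set γ := 3*α + 3*ε - 2 with hγ
  set σ := 3*α - 5/2 + 2*ε with hσ
  set τ := 3*α - 5/2 + ε with hτ
  have hg : ∀ y ≥ (1:ℝ), ‖g y‖ ≤ (3 * C) * y ^ (-γ) := by
    intro y hy
    have hy0 : 0 < y := by linarith
    have h1 : (1 + y^3) ^ (-α - ε) ≤ (y^3) ^ (-α - ε) :=
      Real.rpow_le_rpow_of_nonpos (by positivity) (by linarith) (by linarith)
    have h2 : y^2 * (y^3) ^ (-α - ε) = y ^ (-γ) := by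
      rw [← Real.rpow_natCast, ← Real.rpow_natCast, ← Real.rpow_mul hy0.le, ← Real.rpow_add hy0]
      congr 1
      push_cast
      rw [hγ]; ring
    calc ‖g y‖ ≤ 3 * y^2 * (C * (1 + y^3) ^ (-α - ε)) := hgn y hy0.le
      _ ≤ 3 * y^2 * (C * (y^3) ^ (-α - ε)) := by gcongr
      _ = (3 * C) * (y^2 * (y^3) ^ (-α - ε)) := by ring
      _ = _ := by rw [h2]
  filter_upwards [ae_bound_s5 g hgm (3*C) γ σ (by positivity) (by linarith) hg (by linarith)]
    with lam hlam
  obtain ⟨A, hA, hAb⟩ := hlam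
  let U : ℝ → ℂ := fun M => ∫ y in (0:ℝ)..M, g y * Complex.exp (Complex.I * (lam:ℂ) * (y:ℂ))
  have hint : ∀ M ≥ (0:ℝ), IntervalIntegrable
      (fun y : ℝ => g y * Complex.exp (Complex.I * (lam:ℂ) * (y:ℂ))) volume 0 M := by
    intro M hM
    rw [intervalIntegrable_iff_integrableOn_Ioc_of_le hM]
    refine Measure.integrableOn_of_bounded (M := 3 * M^2 * C) (by simp) ?_ ?_
    · exact Measurable.aestronglyMeasurable (by fun_prop)
    · filter_upwards [ae_restrict_mem measurableSet_Ioc] with y hy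
      rw [norm_mul, norm_ker, mul_one]
      have hy0 := hy.1
      have : (1 + y^3) ^ (-α - ε) ≤ 1 := by
        apply Real.rpow_le_one_of_one_le_of_nonpos _ (by linarith)
        have : 0 < y^3 := by positivity
        linarith
      calc ‖g y‖ ≤ 3 * y^2 * (C * (1 + y^3) ^ (-α - ε)) := hgn y hy0.le
        _ ≤ 3 * M^2 * (C * 1) := by
          have := hy.2
          gcongr
        _ = _ := by ring
  have hU : ∀ a b : ℝ, 0 ≤ a → 0 ≤ b →
      U b - U a = ∫ y in a..b, g y * Complex.exp (Complex.I * (lam:ℂ) * (y:ℂ)) :=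
    fun a b ha hb => intervalIntegral.integral_interval_sub_left (hint b hb) (hint a ha)
  obtain ⟨L, K, hK, hL⟩ := det_lim (fun n => U n) A σ τ hA (by linarith) (by linarith) (by
    intro j m hm
    have := hAb j m hm
    push_cast
    rw [hU _ _ (by positivity) (by positivity), intervalIntegral.integral_of_le (by
      gcongr; linarith)]
    exact this)
  have hM : ∀ M ≥ (1:ℝ), ‖L - U M‖ ≤ ((K + 3*C) * 2^τ) * M ^ (-τ) := by
    intro M hM
    have hn1 : 1 ≤ ⌊M⌋₊ := Nat.one_le_floor_iff M |>.2 hM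
    set n := ⌊M⌋₊
    have hn1' : (1:ℝ) ≤ n := by exact_mod_cast hn1
    have hnM : (n:ℝ) ≤ M := Nat.floor_le (by linarith)
    have hMn : M < n + 1 := Nat.lt_floor_add_one M
    have h1 : ‖U n - U M‖ ≤ 3*C * (n:ℝ)^(-τ) := by
      rw [norm_sub_rev, hU _ _ (by positivity) (by linarith)]
      have := intervalIntegral.norm_integral_le_of_norm_le_const (a := n) (b := M)
        (C := 3*C*(n:ℝ)^(-τ))
        (f := fun y : ℝ => g y * Complex.exp (Complex.I * (lam:ℂ) * (y:ℂ))) (by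
          intro y hy
          rw [uIoc_of_le hnM] at hy
          rw [norm_mul, norm_ker, mul_one]
          refine (hg y (hn1'.trans hy.1.le)).trans ?_
          apply mul_le_mul_of_nonneg_left _ (by positivity)
          exact (Real.rpow_le_rpow_of_nonpos (by linarith) hy.1.le (by linarith)).trans
            (Real.rpow_le_rpow_of_exponent_le hn1' (by linarith)))
      refine this.trans ?_
      apply mul_le_of_le_one_right (by positivity)
      rw [abs_of_nonneg (by linarith)]
      linarith
    have h2 : (n:ℝ)^(-τ) ≤ 2^τ * M^(-τ) := by
      have h3 : (n:ℝ)^(-τ) ≤ (M/2)^(-τ) :=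
        Real.rpow_le_rpow_of_nonpos (by linarith) (by linarith) (by linarith)
      refine h3.trans (le_of_eq ?_)
      rw [Real.div_rpow (by linarith) (by norm_num), Real.rpow_neg (x := 2) (by norm_num) τ, div_inv_eq_mul,
        mul_comm]
    calc ‖L - U M‖ ≤ ‖L - U n‖ + ‖U n - U M‖ := norm_sub_le_norm_sub_add_norm_sub _ _ _
      _ ≤ K * (n:ℝ)^(-τ) + 3*C * (n:ℝ)^(-τ) := add_le_add (hL n hn1) h1
      _ = (K + 3*C) * (n:ℝ)^(-τ) := by ring
      _ ≤ (K + 3*C) * (2^τ * M^(-τ)) := by gcongr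
      _ = _ := by ring
  have hN : ∀ N ≥ (1:ℝ), ‖L - ∫ ξ in (0:ℝ)..N,
      f ξ * Complex.exp (Complex.I * (lam:ℂ) * ((ξ ^ ((1:ℝ)/3) : ℝ) : ℂ))‖
        ≤ ((K + 3*C) * 2^τ) * N ^ (-(τ/3)) := by
    intro N hN
    have hN0 : 0 ≤ N := by linarith
    have e : (N^((1:ℝ)/3))^3 = N := by
      rw [← Real.rpow_natCast, ← Real.rpow_mul hN0]; norm_num
    have h1 := cov f lam (N^((1:ℝ)/3)) (by positivity)
    rw [e] at h1
    rw [h1]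
    refine (hM (N^((1:ℝ)/3)) (Real.one_le_rpow hN (by norm_num))).trans (le_of_eq ?_)
    rw [← Real.rpow_mul hN0]
    congr 2
    ring
  refine ⟨L, ?_, (K + 3*C) * 2^τ, 1, fun N h => (hN N h).trans ?_⟩
  · rw [tendsto_iff_norm_sub_tendsto_zero]
    have h0 : Tendsto (fun N : ℝ => ((K + 3*C) * 2^τ) * N ^ (-(τ/3))) atTop (𝓝 0) := by
      simpa using (tendsto_rpow_neg_atTop (y := τ/3) (by linarith)).const_mul ((K + 3*C) * 2^τ)
    refine squeeze_zero' (Eventually.of_forall fun _ => norm_nonneg _) ?_ h0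
    filter_upwards [eventually_ge_atTop (1:ℝ)] with N h
    rw [norm_sub_rev]
    exact hN N h
  · gcongr
    rw [hτ]; linarith
end

section
/- Let f : [0,∞) → ℝ be continuously differentiable with |f'(x)| ≤ C(1+x)^(−1/2). Then ∫₀^N x^(−1/2) (sin((2/3) x^(3/2) + f(x)))² dx = N^(1/2)(1 + o(1)) as N → ∞. -/
open MeasureTheory Filter Real Set intervalIntegral
open scoped Topology

theorem aux9_bound (f : ℝ → ℝ) (C : ℝ) (hf : ContDiff ℝ 1 f)
    (hf' : ∀ x ≥ (0:ℝ), |deriv f x| ≤ C * (1 + x) ^ (-(1:ℝ)/2)) (N : ℝ) (hN : 1 ≤ N) :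
    |(∫ x in (1:ℝ)..N,
        x ^ (-(1:ℝ)/2) * (Real.sin ((2/3) * x ^ ((3:ℝ)/2) + f x))^2) - N ^ ((1:ℝ)/2)|
      ≤ 2 * (C / 2 + 1 / 4) + 2 := by
  have hC : 0 ≤ C := by
    have h := (abs_nonneg _).trans (hf' 0 le_rfl)
    simpa using h
  have hcf : Continuous f := hf.continuous
  have hcd : Continuous (deriv f) := hf.continuous_deriv le_rfl
  have hd : Differentiable ℝ f := hf.differentiable one_ne_zero
  set g : ℝ → ℝ := fun x => (2/3) * x ^ ((3:ℝ)/2) + f x with hg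
  set R : ℝ → ℝ := fun x => -(Real.cos (2 * g x) * deriv f x / (2 * x)) 
    + Real.sin (2 * g x) / (4 * x ^ 2) with hR
  set h : ℝ → ℝ := fun x => x ^ ((1:ℝ)/2) - Real.sin (2 * g x) / (4 * x) with hh
  have hsub : ∀ x ∈ uIcc 1 N, 0 < x := by
    intro x hx
    rw [uIcc_of_le hN] at hx
    linarith [hx.1]
  have hcg : Continuous g := by
    have : Continuous fun x : ℝ => x ^ ((3:ℝ)/2) :=
      Real.continuous_rpow_const (by norm_num)
    fun_prop
  have hder : ∀ x ∈ uIcc 1 N, HasDerivAt h (x ^ (-(1:ℝ)/2) * (Real.sin (g x))^2 + R x) x := by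
    intro x hx
    have hx0 := hsub x hx
    have hgd : HasDerivAt g ((2/3) * ((3/2) * x ^ ((3:ℝ)/2 - 1)) + deriv f x) x :=
      ((Real.hasDerivAt_rpow_const (Or.inl hx0.ne')).const_mul _).add (hd x).hasDerivAt
    have h1 : HasDerivAt (fun x : ℝ => x ^ ((1:ℝ)/2)) ((1/2) * x ^ ((1:ℝ)/2 - 1)) x :=
      Real.hasDerivAt_rpow_const (Or.inl hx0.ne')
    have h2 := (hgd.const_mul 2).sin
    have h3 : HasDerivAt (fun x : ℝ => 4 * x) (4 * 1) x := (hasDerivAt_id x).const_mul 4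
    have h4 := h1.sub (h2.div h3 (by positivity))
    refine h4.congr_deriv ?_
    have e1 : x ^ ((3:ℝ)/2 - 1) = x * x ^ (-(1:ℝ)/2) := by
      rw [← Real.rpow_one_add' hx0.le (by norm_num)]; norm_num
    have e2 : (1:ℝ)/2 - 1 = -(1:ℝ)/2 := by norm_num
    rw [e1, e2]
    have e3 : Real.cos (2 * g x) = 1 - 2 * Real.sin (g x) ^ 2 := by
      rw [Real.cos_two_mul, Real.cos_sq']; ring
    simp only [hR, e3]
    field_simp
    ring
  have hRc : ContinuousOn R (uIcc 1 N) := by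
    intro x hx
    have hx0 := (hsub x hx).ne'
    apply ContinuousAt.continuousWithinAt
    have := hcg.continuousAt (x := x)
    have := hcd.continuousAt (x := x)
    simp only [hR]
    refine ContinuousAt.add (ContinuousAt.neg (ContinuousAt.div (by fun_prop) (by fun_prop) (by positivity)))
      (ContinuousAt.div (by fun_prop) (by fun_prop) (by positivity))
  have hSc : ContinuousOn (fun x => x ^ (-(1:ℝ)/2) * (Real.sin (g x))^2) (uIcc 1 N) := by
    refine ContinuousOn.mul (fun x hx => ?_) (by fun_prop)
    exact (Real.continuousAt_rpow_const _ _ (Or.inl (hsub x hx).ne')).continuousWithinAt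
  have hftc := integral_eq_sub_of_hasDerivAt hder (hSc.add hRc).intervalIntegrable
  rw [intervalIntegral.integral_add hSc.intervalIntegrable hRc.intervalIntegrable] at hftc
  have hRb : |∫ x in (1:ℝ)..N, R x| ≤ 2 * (C / 2 + 1 / 4) := by
    have hi : IntervalIntegrable (fun x : ℝ => (C / 2 + 1 / 4) * x ^ (-(3:ℝ)/2)) volume 1 N := by
      apply ContinuousOn.intervalIntegrable
      refine ContinuousOn.mul continuousOn_const (fun x hx => ?_)
      exact (Real.continuousAt_rpow_const _ _ (Or.inl (hsub x hx).ne')).continuousWithinAt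
    have := intervalIntegral.norm_integral_le_of_norm_le (f := R) hN
      (g := fun x : ℝ => (C / 2 + 1 / 4) * x ^ (-(3:ℝ)/2)) (ae_of_all _ ?_) hi
    · rw [Real.norm_eq_abs] at this
      refine this.trans ?_
      rw [intervalIntegral.integral_const_mul, integral_rpow
        (Or.inr ⟨by norm_num, fun h0 => lt_irrefl _ (hsub 0 h0)⟩)]
      have : 0 ≤ N ^ (-(3:ℝ)/2 + 1) := by positivity
      rw [mul_comm]
      refine mul_le_mul_of_nonneg_right ?_ (by positivity)
      rw [Real.one_rpow]
      norm_num at this ⊢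
      linarith
    · intro x hx
      have hx1 : 1 < x := hx.1
      have hx0 : 0 < x := by linarith
      have e1 : x ^ (-(3:ℝ)/2) = x ^ (-(1:ℝ)/2) / x := by
        rw [← Real.rpow_sub_one hx0.ne']; norm_num
      have b1 : |deriv f x| ≤ C * x ^ (-(1:ℝ)/2) := by
        refine (hf' x hx0.le).trans (mul_le_mul_of_nonneg_left ?_ hC)
        exact Real.rpow_le_rpow_of_nonpos hx0 (by linarith) (by norm_num)
      have b2 : x ^ (-(2:ℝ)) ≤ x ^ (-(3:ℝ)/2) :=
        Real.rpow_le_rpow_of_exponent_le hx1.le (by norm_num)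
      have e2 : x ^ (-(2:ℝ)) = 1 / x ^ 2 := by
        rw [Real.rpow_neg hx0.le]; norm_num
      have c1 : |-(Real.cos (2 * g x) * deriv f x / (2 * x))| ≤ C / 2 * x ^ (-(3:ℝ)/2) := by
        rw [abs_neg, abs_div, abs_mul, abs_of_pos (show 0 < 2 * x by positivity), e1]
        rw [div_le_iff₀ (by positivity)]
        have := mul_le_mul (Real.abs_cos_le_one (2 * g x)) b1 (abs_nonneg _) zero_le_one
        refine this.trans (le_of_eq ?_)
        field_simp
      have c2 : |Real.sin (2 * g x) / (4 * x ^ 2)| ≤ 1 / 4 * x ^ (-(3:ℝ)/2) := by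
        rw [abs_div, abs_of_pos (show 0 < 4 * x ^ 2 by positivity)]
        calc _ ≤ 1 / (4 * x ^ 2) := by
              gcongr
              exact Real.abs_sin_le_one _
          _ = 1 / 4 * (1 / x ^ 2) := by field_simp
          _ ≤ _ := by rw [← e2]; gcongr
      rw [Real.norm_eq_abs]
      refine (abs_add_le _ _).trans ?_
      linarith
  have hs : ∀ x : ℝ, 1 ≤ x → |Real.sin (2 * g x) / (4 * x)| ≤ 1 / 4 := by
    intro x hx
    rw [abs_div, abs_of_pos (show 0 < 4 * x by positivity), div_le_iff₀ (by positivity)]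
    linarith [Real.abs_sin_le_one (2 * g x)]
  have s1 := abs_le.1 (hs 1 le_rfl)
  have s2 := abs_le.1 (hs N hN)
  have s3 := abs_le.1 hRb
  simp only [hh, Real.one_rpow] at hftc
  rw [abs_le]
  constructor <;> linarith [s1.1, s1.2, s2.1, s2.2, s3.1, s3.2]

theorem stmt9 (f : ℝ → ℝ) (C : ℝ) (hf : ContDiff ℝ 1 f)
    (hf' : ∀ x ≥ (0:ℝ), |deriv f x| ≤ C * (1 + x) ^ (-(1:ℝ)/2)) :
    Tendsto (fun N : ℝ =>
      (∫ x in (0:ℝ)..N,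
        x ^ (-(1:ℝ)/2) * (Real.sin ((2/3) * x ^ ((3:ℝ)/2) + f x))^2) / N ^ ((1:ℝ)/2))
      atTop (𝓝 1) := by
  have hcf : Continuous f := hf.continuous
  have hint : ∀ a b : ℝ, IntervalIntegrable (fun x : ℝ =>
      x ^ (-(1:ℝ)/2) * (Real.sin ((2/3) * x ^ ((3:ℝ)/2) + f x))^2) volume a b := by
    intro a b
    have : Continuous fun x : ℝ => x ^ ((3:ℝ)/2) :=
      Real.continuous_rpow_const (by norm_num)
    exact (intervalIntegral.intervalIntegrable_rpow' (by norm_num)).mul_continuousOn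
      (by fun_prop)
  set A := ∫ x in (0:ℝ)..1, x ^ (-(1:ℝ)/2) * (Real.sin ((2/3) * x ^ ((3:ℝ)/2) + f x))^2 with hA
  have ht : Tendsto (fun N : ℝ => N ^ ((1:ℝ)/2)) atTop atTop :=
    tendsto_rpow_atTop (by norm_num)
  have h0 := ht.const_div_atTop (|A| + (2 * (C / 2 + 1 / 4) + 2))
  rw [tendsto_iff_norm_sub_tendsto_zero]
  refine squeeze_zero' (Eventually.of_forall fun _ => norm_nonneg _) ?_ h0
  filter_upwards [eventually_ge_atTop 1] with N hN
  have hp : 0 < N ^ ((1:ℝ)/2) := by positivity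
  rw [← intervalIntegral.integral_add_adjacent_intervals (hint 0 1) (hint 1 N), ← hA,
    Real.norm_eq_abs, div_sub_one hp.ne', abs_div, abs_of_pos hp, add_sub_assoc]
  gcongr
  exact (abs_add_le _ _).trans (add_le_add le_rfl (aux9_bound f C hf hf' N hN))
end
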